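/- arXiv:2311.06324 — 2 statements merged into one kernel-verified Lean document; each statement's English description precedes it below -/
import Mathlib

section
/- Let H be a weak uniform Glivenko-Cantelli class with M = sup_{f∈H} [sup f − inf f]. Then for every n ∈ ℕ, every P ∈ 𝒫, and every ε > 0, Pⁿ{ ‖P_n − P‖_H* − E[‖P_n − P‖_H*] > ε/2 } ≤ 2 exp( −3nε² / (8M(15M + ε)) ). -/
open MeasureTheory Filter ENNReal

/-- The empirical discrepancy `‖P_n − P‖_H` at the sample `s ∈ Sⁿ`:
the supremum over `f ∈ H` of the distance between the empirical mean of `f`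
at `s` and the integral of `f` with respect to `P`. -/
noncomputable def empDev {S : Type*} [MeasurableSpace S] (H : Set (S → ℝ))
    (P : MeasureTheory.Measure S) (n : ℕ) (s : Fin n → S) : ℝ :=
  ⨆ f ∈ H, |(∑ i, f (s i)) / n - ∫ x, f x ∂P|

/-- The empirical discrepancy `‖P_k − P‖_H` computed from the first `k` coordinates of an
infinite sample `ω ∈ S^∞`. -/
noncomputable def empDevSeq {S : Type*} [MeasurableSpace S] (H : Set (S → ℝ))
    (P : MeasureTheory.Measure S) (k : ℕ) (ω : ℕ → S) : ℝ :=
  ⨆ f ∈ H, |(∑ i ∈ Finset.range k, f (ω i)) / k - ∫ x, f x ∂P|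

/-- `M = sup_{f ∈ H} [sup f − inf f]`, valued in the extended reals. -/
noncomputable def gcM {S : Type*} (H : Set (S → ℝ)) : EReal :=
  ⨆ f ∈ H, ((⨆ x, (f x : EReal)) - ⨅ x, (f x : EReal))

/-- `M = sup_{f ∈ H} [sup f − inf f]`, as a real number (junk value conventions of `ℝ`-valued
`⨆`/`⨅` apply when the quantities involved are unbounded). -/
noncomputable def gcMReal {S : Type*} (H : Set (S → ℝ)) : ℝ :=
  ⨆ f ∈ H, ((⨆ x, f x) - ⨅ x, f x)

/-- The upper expectation `E[g*]` of `g` with respect to `μ`: the infimum of the integrals of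
integrable measurable (everywhere) majorants of `g`.  When `g` admits an integrable measurable
cover function `g*`, this is exactly `E[g*]`. -/
noncomputable def upperExp {α : Type*} [MeasurableSpace α] (μ : MeasureTheory.Measure α)
    (g : α → ℝ) : ℝ :=
  sInf {r | ∃ h : α → ℝ, Measurable h ∧ (∀ x, g x ≤ h x) ∧
    MeasureTheory.Integrable h μ ∧ r = ∫ x, h x ∂μ}

/-- `μ` is the countable product `P^∞` of copies of the probability measure `P`:
it is a probability measure on `ℕ → S` whose finite-dimensional projections are the
finite product measures `Pⁿ`. -/
def IsCountableProduct {S : Type*} [MeasurableSpace S] (P : MeasureTheory.Measure S)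
    (μ : MeasureTheory.Measure (ℕ → S)) : Prop :=
  MeasureTheory.IsProbabilityMeasure μ ∧
    ∀ n : ℕ, μ.map (fun ω (i : Fin n) => ω i) = MeasureTheory.Measure.pi fun _ : Fin n => P

/-- `H` is a weak uniform Glivenko–Cantelli class: for every `ε > 0`,
`sup_{P ∈ 𝒫} Pⁿ{‖P_n − P‖_H > ε} → 0` as `n → ∞` (sets of non-measurable events are
measured by the outer measure, i.e. by the measure of a measurable cover). -/
def IsWeakUniformGC {S : Type*} [MeasurableSpace S] (H : Set (S → ℝ)) : Prop :=
  ∀ ε : ℝ, 0 < ε →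
    Tendsto (fun n : ℕ => ⨆ P : {P : MeasureTheory.Measure S // MeasureTheory.IsProbabilityMeasure P},
        (MeasureTheory.Measure.pi fun _ : Fin n => P.1) {s | ε < empDev H P.1 n s})
      atTop (nhds 0)

/-- `H` is a strong uniform Glivenko–Cantelli class: for every assignment `P ↦ P^∞` of countable
product measures and every `ε > 0`,
`sup_{P ∈ 𝒫} P^∞{sup_{k ≥ n} ‖P_k − P‖_H > ε} → 0` as `n → ∞`. -/
def IsStrongUniformGC {S : Type*} [MeasurableSpace S] (H : Set (S → ℝ)) : Prop :=
  ∀ Pinf : {P : MeasureTheory.Measure S // MeasureTheory.IsProbabilityMeasure P} →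
      MeasureTheory.Measure (ℕ → S),
    (∀ P, IsCountableProduct P.1 (Pinf P)) →
    ∀ ε : ℝ, 0 < ε →
      Tendsto (fun n : ℕ => ⨆ P : {P : MeasureTheory.Measure S // MeasureTheory.IsProbabilityMeasure P},
          Pinf P {ω | ∃ k, n ≤ k ∧ ε < empDevSeq H P.1 k ω})
        atTop (nhds 0)

/-- `h` is a measurable cover function (minimal measurable majorant) of `g` w.r.t. `μ`. -/
def IsMeasCover {α : Type*} [MeasurableSpace α] (μ : MeasureTheory.Measure α)
    (g h : α → ℝ) : Prop :=
  Measurable h ∧ (∀ᵐ x ∂μ, g x ≤ h x) ∧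
    ∀ h' : α → ℝ, Measurable h' → (∀ᵐ x ∂μ, g x ≤ h' x) → ∀ᵐ x ∂μ, h x ≤ h' x

open Function

/-- **Hoeffding's lemma** for a bounded random variable any two independent copies of which
differ by at most `c`. -/
theorem integral_exp_le_of_ae_ae_le_add {S : Type*} [MeasurableSpace S] {P : Measure S}
    [IsProbabilityMeasure P] {X : S → ℝ} {c : ℝ} (hX : Measurable X) (hc : 0 ≤ c)
    (h : ∀ᵐ y ∂P, ∀ᵐ x ∂P, X x ≤ X y + c) (t : ℝ) :
    ∫ x, Real.exp (t * X x) ∂P ≤ Real.exp (t * ∫ x, X x ∂P + c ^ 2 * t ^ 2 / 2) := by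
  have h_swap : ∀ᵐ y ∂P, ∀ᵐ x ∂P, X y ≤ X x + c :=
    (Measure.ae_ae_comm (p := fun y x => X x ≤ X y + c)
      (measurableSet_le (hX.comp measurable_snd) ((hX.comp measurable_fst).add_const c))).1 h
  obtain ⟨y, hy_above, hy_below⟩ := (h.and h_swap).exists
  have hIcc : ∀ᵐ x ∂P, X x ∈ Set.Icc (X y - c) (X y + c) := by
    filter_upwards [hy_above, hy_below] with x h1 h2 using ⟨by linarith, h1⟩
  have hmgf := (ProbabilityTheory.hasSubgaussianMGF_of_mem_Icc hX.aemeasurable hIcc).mgf_le t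
  have hwidth : ((((‖X y + c - (X y - c)‖₊ / 2) ^ 2 : NNReal)) : ℝ) = c ^ 2 := by
    have : X y + c - (X y - c) = 2 * c := by ring
    rw [this]
    simp [abs_of_nonneg hc]
  rw [hwidth, ProbabilityTheory.mgf] at hmgf
  have hsplit : ∀ x, Real.exp (t * X x) =
      Real.exp (t * ∫ x, X x ∂P) * Real.exp (t * (X x - ∫ x, X x ∂P)) := by
    intro x
    rw [← Real.exp_add]
    ring_nf
  simp_rw [hsplit]
  rw [integral_const_mul, Real.exp_add]
  gcongr

/-- Prepending an independent coordinate to `n` independent ones gives `n + 1` of them. -/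
theorem measurePreserving_finCons {S : Type*} [MeasurableSpace S] (P : Measure S)
    [IsProbabilityMeasure P] (n : ℕ) :
    MeasurePreserving (fun z : (Fin n → S) × S => (Fin.cons z.2 z.1 : Fin (n + 1) → S))
      ((Measure.pi fun _ : Fin n => P).prod P) (Measure.pi fun _ : Fin (n + 1) => P) := by
  have h := ((measurePreserving_piFinSuccAbove (fun _ : Fin (n + 1) => P) 0).symm).comp
    (Measure.measurePreserving_swap (μ := Measure.pi fun _ : Fin n => P) (ν := P))
  convert h using 1
  ext z
  simp [MeasurableEquiv.piFinSuccAbove, Fin.insertNthEquiv]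

theorem integrable_of_forall_abs_le {α : Type*} [MeasurableSpace α] {μ : Measure α}
    [IsFiniteMeasure μ] {g : α → ℝ} {B : ℝ} (hg : Measurable g) (hB : ∀ x, |g x| ≤ B) :
    Integrable g μ :=
  Integrable.of_bound hg.aestronglyMeasurable B (ae_of_all _ hB)

theorem integrable_exp_mul_of_forall_abs_le {α : Type*} [MeasurableSpace α] {μ : Measure α}
    [IsFiniteMeasure μ] {g : α → ℝ} {B : ℝ} (hg : Measurable g) (hB : ∀ x, |g x| ≤ B) (t : ℝ) :
    Integrable (fun x => Real.exp (t * g x)) μ :=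
  ProbabilityTheory.integrable_exp_mul_of_mem_Icc hg.aemeasurable
    (ae_of_all _ fun x => abs_le.1 (hB x))

/-- Exponential moment bound behind **McDiarmid's inequality**, for functions whose bounded
difference property holds only almost everywhere. -/
theorem integral_exp_le_of_ae_le_update_add {S : Type*} [MeasurableSpace S] (P : Measure S)
    [IsProbabilityMeasure P] {c : ℝ} (hc : 0 ≤ c) (t : ℝ) {B : ℝ} :
    ∀ (n : ℕ) (g : (Fin n → S) → ℝ), Measurable g → (∀ s, |g s| ≤ B) →
      (∀ i y, ∀ᵐ s ∂(Measure.pi fun _ : Fin n => P), g s ≤ g (update s i y) + c) →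
      ∫ s, Real.exp (t * g s) ∂(Measure.pi fun _ : Fin n => P) ≤
        Real.exp (t * ∫ s, g s ∂(Measure.pi fun _ : Fin n => P) + n * (c ^ 2 * t ^ 2 / 2)) := by
  intro n
  induction n with
  | zero =>
    intro g _ _ _
    have hg : ∀ s, g s = g default := fun s => by rw [Subsingleton.elim s default]
    simp_rw [hg]
    simp
  | succ n ih =>
    intro g hg hB hdiff
    have hcons := measurePreserving_finCons P n
    have hgc : Measurable fun z : (Fin n → S) × S => g (Fin.cons z.2 z.1) :=
      hg.comp hcons.measurable
    have hslice : ∀ s : Fin n → S, Measurable fun x => g (Fin.cons x s) := fun s =>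
      hgc.comp measurable_prodMk_left
    set G : (Fin n → S) → ℝ := fun s => ∫ x, g (Fin.cons x s) ∂P with hG_def
    have hG : Measurable G := (hgc.stronglyMeasurable.integral_prod_right').measurable
    have hGB : ∀ s, |G s| ≤ B := fun s => by
      simpa using norm_integral_le_of_norm_le_const (μ := P) (f := fun x => g (Fin.cons x s))
        (ae_of_all _ fun x => hB (Fin.cons x s))
    have hGdiff : ∀ i y, ∀ᵐ s ∂(Measure.pi fun _ : Fin n => P), G s ≤ G (update s i y) + c := by
      intro i y
      have h := Measure.ae_ae_of_ae_prod (hcons.quasiMeasurePreserving.ae (hdiff i.succ y))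
      filter_upwards [h] with s hs
      have hint : ∀ s : Fin n → S, Integrable (fun x => g (Fin.cons x s)) P := fun s =>
        integrable_of_forall_abs_le (hslice s) fun x => hB _
      calc G s ≤ ∫ x, (g (Fin.cons x (update s i y)) + c) ∂P := by
            refine integral_mono_ae (hint s) ((hint _).add (integrable_const c)) ?_
            filter_upwards [hs] with x hx
            simpa [Fin.cons_update] using hx
        _ = G (update s i y) + c := by
            rw [integral_add (hint _) (integrable_const c)]
            simp [hG_def]
    have hfirst : ∀ᵐ s ∂(Measure.pi fun _ : Fin n => P), ∀ᵐ y ∂P, ∀ᵐ x ∂P,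
        g (Fin.cons x s) ≤ g (Fin.cons y s) + c := by
      have hmeas : MeasurableSet {q : ((Fin n → S) × S) |
          ∀ᵐ x ∂P, g (Fin.cons x q.1) ≤ g (Fin.cons q.2 q.1) + c} := by
        have hset : MeasurableSet {r : ((Fin n → S) × S) × S |
            g (Fin.cons r.2 r.1.1) ≤ g (Fin.cons r.1.2 r.1.1) + c} :=
          measurableSet_le
            (hgc.comp ((measurable_fst.comp measurable_fst).prodMk measurable_snd))
            ((hgc.comp measurable_fst).add_const c)
        exact measurable_measure_prodMk_left hset.compl (measurableSet_singleton 0)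
      refine (Measure.ae_ae_comm hmeas).2 (ae_of_all _ fun y => ?_)
      have h := Measure.ae_ae_of_ae_prod (hcons.quasiMeasurePreserving.ae (hdiff 0 y))
      simpa only [Fin.update_cons_zero] using h
    have hexpG := integrable_exp_mul_of_forall_abs_le
      (μ := Measure.pi fun _ : Fin n => P) hG hGB t
    have hexpg := integrable_exp_mul_of_forall_abs_le
      (μ := (Measure.pi fun _ : Fin n => P).prod P) hgc (fun z => hB _) t
    have hmean : ∫ s, g s ∂(Measure.pi fun _ : Fin (n + 1) => P) =
        ∫ s, G s ∂(Measure.pi fun _ : Fin n => P) := by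
      rw [← hcons.map_eq, integral_map hcons.aemeasurable hg.aestronglyMeasurable,
        integral_prod _ (integrable_of_forall_abs_le hgc fun z => hB _)]
    rw [hmean, ← hcons.map_eq, integral_map hcons.aemeasurable
      (hg.const_mul t).exp.aestronglyMeasurable, integral_prod _ hexpg]
    calc ∫ s, ∫ x, Real.exp (t * g (Fin.cons x s)) ∂P ∂(Measure.pi fun _ : Fin n => P)
        ≤ ∫ s, Real.exp (c ^ 2 * t ^ 2 / 2) * Real.exp (t * G s)
            ∂(Measure.pi fun _ : Fin n => P) := by
          refine integral_mono_ae hexpg.integral_prod_left (hexpG.const_mul _) ?_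
          filter_upwards [hfirst] with s hs
          rw [← Real.exp_add, add_comm (c ^ 2 * t ^ 2 / 2)]
          exact integral_exp_le_of_ae_ae_le_add (hslice s) hc hs t
      _ ≤ Real.exp (c ^ 2 * t ^ 2 / 2) *
            Real.exp (t * ∫ s, G s ∂(Measure.pi fun _ : Fin n => P) +
              n * (c ^ 2 * t ^ 2 / 2)) := by
          rw [integral_const_mul]
          gcongr
          exact ih G hG hGB hGdiff
      _ = _ := by
          rw [← Real.exp_add]
          push_cast
          ring_nf

/-- **McDiarmid's inequality**, with a non-optimal constant, for functions whose bounded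
difference property holds only almost everywhere. -/
theorem measureReal_pi_le_exp_of_ae_le_update_add {S : Type*} [MeasurableSpace S]
    (P : Measure S) [IsProbabilityMeasure P] {n : ℕ} (hn : 0 < n) {c B r : ℝ} (hc : 0 < c)
    (hr : 0 ≤ r) {g : (Fin n → S) → ℝ} (hg : Measurable g) (hB : ∀ s, |g s| ≤ B)
    (hdiff : ∀ i y, ∀ᵐ s ∂(Measure.pi fun _ : Fin n => P), g s ≤ g (update s i y) + c) :
    (Measure.pi fun _ : Fin n => P).real
        {s | ∫ s, g s ∂(Measure.pi fun _ : Fin n => P) + r ≤ g s} ≤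
      Real.exp (-(r ^ 2 / (2 * n * c ^ 2))) := by
  have hn' : (0 : ℝ) < n := Nat.cast_pos.2 hn
  set m := ∫ s, g s ∂(Measure.pi fun _ : Fin n => P)
  set t := r / (n * c ^ 2) with ht_def
  have ht : 0 ≤ t := by positivity
  calc _ ≤ Real.exp (-t * (m + r)) * ProbabilityTheory.mgf g (Measure.pi fun _ : Fin n => P) t :=
        ProbabilityTheory.measure_ge_le_exp_mul_mgf _ ht
          (integrable_exp_mul_of_forall_abs_le hg hB t)
    _ ≤ Real.exp (-t * (m + r)) * Real.exp (t * m + n * (c ^ 2 * t ^ 2 / 2)) := by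
        gcongr
        exact integral_exp_le_of_ae_le_update_add P hc.le t n g hg hB hdiff
    _ = _ := by
        rw [← Real.exp_add, ht_def]
        congr 1
        field_simp
        ring

/-- A bounded function on a finite measure space has a measurable majorant which is minimal up to
null sets. -/
theorem exists_measurable_ge_ae_le {α : Type*} [MeasurableSpace α] (μ : Measure α)
    [IsFiniteMeasure μ] {Z : α → ℝ} {M : ℝ} (h0 : ∀ x, 0 ≤ Z x) (hM : ∀ x, Z x ≤ M) :
    ∃ g : α → ℝ, Measurable g ∧ (∀ x, Z x ≤ g x) ∧ (∀ x, g x ≤ M) ∧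
      ∀ h : α → ℝ, Measurable h → (∀ x, Z x ≤ h x) → g ≤ᵐ[μ] h := by
  obtain ⟨u, hu, hu_le, hu_int⟩ :=
    exists_measurable_le_lintegral_eq μ fun x => ENNReal.ofReal (M - Z x)
  have hu_top : ∀ x, u x ≠ ∞ := fun x => ((hu_le x).trans_lt ofReal_lt_top).ne
  refine ⟨fun x => M - (u x).toReal, hu.ennreal_toReal.const_sub M, fun x => ?_, fun x => ?_,
    fun h hh hZh => ?_⟩
  · have := toReal_le_of_le_ofReal (sub_nonneg.2 (hM x)) (hu_le x)
    linarith
  · have := (u x).toReal_nonneg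
    linarith
  · have hle : ∀ x, (u x ⊔ ENNReal.ofReal (M - h x)) ≤ ENNReal.ofReal (M - Z x) := fun x =>
      sup_le (hu_le x) (ofReal_le_ofReal (by linarith [hZh x]))
    have hfin : ∫⁻ x, u x ∂μ ≠ ∞ := by
      refine ((lintegral_mono fun x => (hu_le x).trans
        (ofReal_le_ofReal (sub_le_self M (h0 x)))).trans_lt ?_).ne
      rw [lintegral_const]
      exact mul_lt_top ofReal_lt_top (measure_lt_top μ _)
    have heq := ae_eq_of_ae_le_of_lintegral_le (ae_of_all μ fun x => le_sup_left) hfin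
      (hu.sup (hh.const_sub M).ennreal_ofReal).aemeasurable
      ((lintegral_mono hle).trans hu_int.le)
    filter_upwards [heq] with x hx
    have hle_u : ENNReal.ofReal (M - h x) ≤ u x := hx ▸ le_sup_right
    have := (ofReal_le_iff_le_toReal (hu_top x)).1 hle_u
    linarith

/-- McDiarmid's inequality for a possibly non-measurable function, in terms of outer measure
and upper expectation. -/
theorem measure_pi_lt_sub_upperExp_le {S : Type*} [MeasurableSpace S]
    (P : Measure S) [IsProbabilityMeasure P] {n : ℕ} (hn : 0 < n) {c M r : ℝ} (hc : 0 < c)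
    (hr : 0 ≤ r) {Z : (Fin n → S) → ℝ} (h0 : ∀ s, 0 ≤ Z s) (hM : ∀ s, Z s ≤ M)
    (hdiff : ∀ s i y, Z s ≤ Z (update s i y) + c) :
    (Measure.pi fun _ : Fin n => P)
        {s | r < Z s - upperExp (Measure.pi fun _ : Fin n => P) Z} ≤
      ENNReal.ofReal (Real.exp (-(r ^ 2 / (2 * n * c ^ 2)))) := by
  obtain ⟨g, hg, hZg, hgM, hmin⟩ :=
    exists_measurable_ge_ae_le (Measure.pi fun _ : Fin n => P) h0 hM
  have hgB : ∀ s, |g s| ≤ M := fun s =>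
    abs_le.2 ⟨by linarith [h0 s, hM s, hZg s], hgM s⟩
  have hgdiff : ∀ i y, ∀ᵐ s ∂(Measure.pi fun _ : Fin n => P), g s ≤ g (update s i y) + c := by
    intro i y
    refine hmin _ ((hg.comp (measurable_pi_iff.2 fun j => ?_)).add_const c) fun s =>
      (hdiff s i y).trans (by linarith [hZg (update s i y)])
    rcases eq_or_ne j i with rfl | hj
    · simp
    · simpa [update_of_ne hj] using measurable_pi_apply j
  have hgint : Integrable g (Measure.pi fun _ : Fin n => P) := integrable_of_forall_abs_le hg hgB
  have hmean : ∫ s, g s ∂(Measure.pi fun _ : Fin n => P) ≤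
      upperExp (Measure.pi fun _ : Fin n => P) Z := by
    refine le_csInf ⟨_, g, hg, hZg, hgint, rfl⟩ ?_
    rintro _ ⟨h, hh, hZh, hhint, rfl⟩
    exact integral_mono_ae hgint hhint (hmin h hh hZh)
  calc _ ≤ (Measure.pi fun _ : Fin n => P)
        {s | ∫ s, g s ∂(Measure.pi fun _ : Fin n => P) + r ≤ g s} := by
        refine measure_mono fun s (hs : r < _) => ?_
        have := hZg s
        change _ + r ≤ g s
        linarith
    _ ≤ _ := by
        rw [← ofReal_measureReal]
        exact ofReal_le_ofReal
          (measureReal_pi_le_exp_of_ae_le_update_add P hn hc hr hg hgB hgdiff)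

/-- A function which is integrable for every probability measure is bounded. -/
theorem exists_forall_abs_le_of_forall_integrable {S : Type*} [MeasurableSpace S] {f : S → ℝ}
    (hf : ∀ P : Measure S, IsProbabilityMeasure P → Integrable f P) : ∃ B, ∀ x, |f x| ≤ B := by
  by_contra! hunb
  choose x hx using fun k : ℕ => hunb (4 ^ (k + 1))
  let P : Measure S := Measure.sum fun k : ℕ => (2⁻¹ : ℝ≥0∞) ^ (k + 1) • Measure.dirac (x k)
  have hP : IsProbabilityMeasure P := ⟨by
    rw [Measure.sum_apply _ MeasurableSet.univ]
    simpa [ENNReal.inv_mul_cancel two_ne_zero ofNat_ne_top] using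
      ENNReal.tsum_geometric_add_one 2⁻¹⟩
  have hfP := hf P hP
  have hlower : ∀ k : ℕ, (2 : ℝ≥0∞) ^ (k + 1) ≤ ∫⁻ y, ‖f y‖ₑ ∂P := by
    intro k
    have hmass : (2⁻¹ : ℝ≥0∞) ^ (k + 1) ≤ P {y | (4 : ℝ≥0∞) ^ (k + 1) ≤ ‖f y‖ₑ} := by
      have hmem : x k ∈ {y | (4 : ℝ≥0∞) ^ (k + 1) ≤ ‖f y‖ₑ} := by
        have h := ofReal_le_ofReal (hx k).le
        rw [ofReal_pow (by norm_num)] at h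
        simpa [Real.enorm_eq_ofReal_abs] using h
      calc (2⁻¹ : ℝ≥0∞) ^ (k + 1)
          = ((2⁻¹ : ℝ≥0∞) ^ (k + 1) • Measure.dirac (x k))
              {y | (4 : ℝ≥0∞) ^ (k + 1) ≤ ‖f y‖ₑ} := by
            simp [Measure.dirac_apply_of_mem hmem]
        _ ≤ _ := Measure.le_sum (fun k : ℕ => (2⁻¹ : ℝ≥0∞) ^ (k + 1) • Measure.dirac (x k)) k _
    calc (2 : ℝ≥0∞) ^ (k + 1) = 4 ^ (k + 1) * 2⁻¹ ^ (k + 1) := by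
          have h4 : (4 : ℝ≥0∞) = 2 * 2 := by norm_num
          rw [← mul_pow, h4, mul_assoc, ENNReal.mul_inv_cancel two_ne_zero ofNat_ne_top, mul_one]
      _ ≤ 4 ^ (k + 1) * P {y | (4 : ℝ≥0∞) ^ (k + 1) ≤ ‖f y‖ₑ} := by gcongr
      _ ≤ _ := mul_meas_ge_le_lintegral₀ hfP.aestronglyMeasurable.enorm _
  have hfin : ∫⁻ y, ‖f y‖ₑ ∂P < ∞ := hfP.hasFiniteIntegral
  refine hfin.ne (top_le_iff.1 ?_)
  refine le_of_tendsto' ENNReal.tendsto_nat_nhds_top fun k => le_trans ?_ (hlower k)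
  exact_mod_cast (k.lt_succ_self.trans (k + 1).lt_two_pow_self).le

/-- If `gcMReal H` is nonzero, hence not a junk value, it bounds all oscillations. -/
theorem abs_sub_le_gcMReal {S : Type*} {H : Set (S → ℝ)} (hM : gcMReal H ≠ 0) {f : S → ℝ}
    (hf : f ∈ H) (hbdd : ∃ B, ∀ x, |f x| ≤ B) (x y : S) : |f x - f y| ≤ gcMReal H := by
  obtain ⟨B, hB⟩ := hbdd
  have habove : BddAbove (Set.range f) :=
    ⟨B, by rintro _ ⟨z, rfl⟩; exact (abs_le.1 (hB z)).2⟩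
  have hbelow : BddBelow (Set.range f) :=
    ⟨-B, by rintro _ ⟨z, rfl⟩; exact (abs_le.1 (hB z)).1⟩
  have hosc : |f x - f y| ≤ (⨆ x, f x) - ⨅ x, f x := by
    have := le_ciSup habove x
    have := le_ciSup habove y
    have := ciInf_le hbelow x
    have := ciInf_le hbelow y
    rw [abs_le]
    constructor <;> linarith
  have hH : BddAbove (Set.range fun f : S → ℝ => ⨆ _ : f ∈ H, ((⨆ x, f x) - ⨅ x, f x)) := by
    by_contra h
    exact hM (Real.iSup_of_not_bddAbove h)
  refine hosc.trans ?_
  have := le_ciSup hH f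
  rwa [ciSup_pos hf] at this

/-- The empirical mean of a function of oscillation at most `M` is within `M` of its mean. -/
theorem abs_empMean_sub_integral_le {S : Type*} [MeasurableSpace S] {P : Measure S}
    [IsProbabilityMeasure P] {f : S → ℝ} (hf : Integrable f P) {M : ℝ}
    (hM : ∀ x y, |f x - f y| ≤ M) {n : ℕ} (hn : 0 < n) (s : Fin n → S) :
    |(∑ i, f (s i)) / n - ∫ x, f x ∂P| ≤ M := by
  have hn' : (0 : ℝ) < n := Nat.cast_pos.2 hn
  have hpoint : ∀ x, |f x - ∫ y, f y ∂P| ≤ M := by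
    intro x
    have h : f x - ∫ y, f y ∂P = ∫ y, (f x - f y) ∂P := by
      rw [integral_sub (integrable_const _) hf]
      simp
    rw [h]
    simpa using norm_integral_le_of_norm_le_const (μ := P) (f := fun y => f x - f y)
      (ae_of_all _ fun y => hM x y)
  have h : (∑ i, f (s i)) / n - ∫ x, f x ∂P = (∑ i, (f (s i) - ∫ x, f x ∂P)) / n := by
    rw [Finset.sum_sub_distrib]
    simp
    field_simp
  rw [h, abs_div, abs_of_pos hn', div_le_iff₀ hn']
  refine (Finset.abs_sum_le_sum_abs _ _).trans
    ((Finset.sum_le_card_nsmul _ _ _ fun i _ => hpoint (s i)).trans_eq ?_)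
  simp [mul_comm]

/-- Changing one observation changes the empirical mean by at most `M / n`. -/
theorem abs_empMean_sub_empMean_update_le {S : Type*} {f : S → ℝ} {M : ℝ}
    (hM : ∀ x y, |f x - f y| ≤ M) {n : ℕ} (s : Fin n → S) (i : Fin n) (y : S) :
    |(∑ j, f (s j)) / n - (∑ j, f (update s i y j)) / n| ≤ M / n := by
  rw [← sub_div, ← Finset.sum_sub_distrib, abs_div, Nat.abs_cast]
  gcongr
  rw [Finset.sum_eq_single i (fun j _ hj => by simp [update_of_ne hj]) (by simp)]
  exact hM _ _

section empDev

variable {S : Type*} [MeasurableSpace S] {H : Set (S → ℝ)} {P : Measure S} {n : ℕ}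

theorem empDev_nonneg (s : Fin n → S) : 0 ≤ empDev H P n s :=
  Real.iSup_nonneg fun _ => Real.iSup_nonneg fun _ => abs_nonneg _

theorem empDev_le {s : Fin n → S} {a : ℝ} (ha : 0 ≤ a)
    (h : ∀ f ∈ H, |(∑ i, f (s i)) / n - ∫ x, f x ∂P| ≤ a) : empDev H P n s ≤ a :=
  Real.iSup_le (fun f => Real.iSup_le (fun hf => h f hf) ha) ha

theorem le_empDev {s : Fin n → S} {a : ℝ} (ha : 0 ≤ a)
    (h : ∀ f ∈ H, |(∑ i, f (s i)) / n - ∫ x, f x ∂P| ≤ a) {f : S → ℝ} (hf : f ∈ H) :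
    |(∑ i, f (s i)) / n - ∫ x, f x ∂P| ≤ empDev H P n s := by
  have hbdd : BddAbove (Set.range fun f : S → ℝ =>
      ⨆ _ : f ∈ H, |(∑ i, f (s i)) / n - ∫ x, f x ∂P|) :=
    ⟨a, by rintro _ ⟨f, rfl⟩; exact Real.iSup_le (fun hf => h f hf) ha⟩
  have := le_ciSup hbdd f
  rwa [ciSup_pos hf] at this

end empDev

/-- Kutin-type concentration: if `H` is a weak uniform Glivenko–Cantelli class with
`M = sup_{f ∈ H} [sup f − inf f]`, then for every `n`, every probability measure `P` and
every `ε > 0`,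
`Pⁿ{ ‖P_n − P‖_H* − E[‖P_n − P‖_H*] > ε/2 } ≤ 2 exp(−3nε² / (8M(15M + ε)))`. -/
theorem concentration_of_weakUniformGC {S : Type*} [MeasurableSpace S]
    (H : Set (S → ℝ))
    (hH : ∃ f ∈ H, ∃ x y : S, f x ≠ f y)
    (hint : ∀ f ∈ H, ∀ P : MeasureTheory.Measure S, MeasureTheory.IsProbabilityMeasure P →
      MeasureTheory.Integrable f P)
    (hweak : IsWeakUniformGC H) :
    ∀ (n : ℕ) (P : MeasureTheory.Measure S), MeasureTheory.IsProbabilityMeasure P →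
      ∀ ε : ℝ, 0 < ε →
        (MeasureTheory.Measure.pi fun _ : Fin n => P)
            {s | ε / 2 < empDev H P n s -
              upperExp (MeasureTheory.Measure.pi fun _ : Fin n => P) (empDev H P n)} ≤
          ENNReal.ofReal (2 * Real.exp (-(3 * n * ε ^ 2) /
            (8 * gcMReal H * (15 * gcMReal H + ε)))) := by
  intro n P hP ε hε
  rcases eq_or_ne (gcMReal H) 0 with hM | hM
  · refine prob_le_one.trans ?_
    simp [hM]
  rcases Nat.eq_zero_or_pos n with rfl | hn
  · refine prob_le_one.trans ?_
    simp
  have hosc : ∀ f ∈ H, ∀ x y, |f x - f y| ≤ gcMReal H := fun f hf =>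
    abs_sub_le_gcMReal hM hf (exists_forall_abs_le_of_forall_integrable (hint f hf))
  have hMpos : 0 < gcMReal H := by
    obtain ⟨f, hf, x, y, hxy⟩ := hH
    exact (abs_pos.2 (sub_ne_zero.2 hxy)).trans_le (hosc f hf x y)
  have hn' : (0 : ℝ) < n := Nat.cast_pos.2 hn
  have hdev : ∀ (s : Fin n → S), ∀ f ∈ H,
      |(∑ i, f (s i)) / n - ∫ x, f x ∂P| ≤ gcMReal H := fun s f hf =>
    abs_empMean_sub_integral_le (hint f hf P hP) (hosc f hf) hn s
  have hdiff : ∀ (s : Fin n → S) (i : Fin n) (y : S),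
      empDev H P n s ≤ empDev H P n (update s i y) + gcMReal H / n := by
    intro s i y
    refine empDev_le (add_nonneg (empDev_nonneg _) (by positivity)) fun f hf => ?_
    have h := abs_add_le ((∑ j, f (update s i y j)) / n - ∫ x, f x ∂P)
      ((∑ j, f (s j)) / n - (∑ j, f (update s i y j)) / n)
    have hupdate := le_empDev hMpos.le (hdev (update s i y)) hf
    have hchange := abs_empMean_sub_empMean_update_le (hosc f hf) s i y
    rw [sub_add_sub_cancel'] at h
    linarith
  refine (measure_pi_lt_sub_upperExp_le P hn (div_pos hMpos hn') (half_pos hε).le empDev_nonneg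
    (fun s => empDev_le hMpos.le (hdev s)) hdiff).trans (ofReal_le_ofReal ?_)
  set M := gcMReal H
  have hexp : -((ε / 2) ^ 2 / (2 * n * (M / n) ^ 2)) ≤
      -(3 * n * ε ^ 2) / (8 * M * (15 * M + ε)) := by
    rw [neg_div, neg_le_neg_iff]
    have h : (ε / 2) ^ 2 / (2 * n * (M / n) ^ 2) = n * ε ^ 2 / (8 * M ^ 2) := by
      field_simp
      ring
    rw [h, div_le_div_iff₀ (by positivity) (by positivity)]
    have : 0 ≤ n * ε ^ 2 * M * (12 * M + ε) := by positivity
    nlinarith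
  have := Real.exp_le_exp.2 hexp
  have := Real.exp_pos (-(3 * n * ε ^ 2) / (8 * M * (15 * M + ε)))
  linarith
end

section
/- Let H be a class of real-valued functions on S with |f(x) − f(y)| ≤ M for all f ∈ H and all x, y ∈ S, and fix n ∈ ℕ and P ∈ 𝒫. Then for Pⁿ⁺¹-almost every (s, y) ∈ Sⁿ × S, writing s′ for s with its i-th coordinate replaced by y, | ‖P_s − P‖_H* − ‖P_{s′} − P‖_H* | ≤ M/n; that is, after a possible null-set modification, the function ‖P_n − P‖_H* is weakly difference-bounded by (4M, M n⁻¹, 0). -/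
open MeasureTheory Filter ENNReal

/-- If two real-valued families differ by at most `c`, then so do their suprema, even when these are
infinite and hence equal to `0` by convention. -/
theorem Real.iSup_le_iSup_add {ι : Sort*} {F G : ι → ℝ} {c : ℝ} (hc : 0 ≤ c)
    (hFG : ∀ j, |F j - G j| ≤ c) : ⨆ j, F j ≤ (⨆ j, G j) + c := by
  rcases isEmpty_or_nonempty ι with _ | _
  · simpa using hc
  by_cases hG : BddAbove (Set.range G)
  · exact ciSup_le fun j => by linarith [(abs_le.1 (hFG j)).2, le_ciSup hG j]
  · have hF : ¬ BddAbove (Set.range F) := by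
      rintro ⟨b, hb⟩
      refine hG ⟨b + c, ?_⟩
      rintro _ ⟨j, rfl⟩
      linarith [(abs_le.1 (hFG j)).1, hb ⟨j, rfl⟩]
    rw [Real.iSup_of_not_bddAbove hF, Real.iSup_of_not_bddAbove hG]
    simpa using hc

/-- Changing one coordinate of the sample changes the empirical discrepancy by at most `M / n`. -/
theorem empDev_le_empDev_update_add {S : Type*} [MeasurableSpace S] {H : Set (S → ℝ)}
    (hne : H.Nonempty) {M : ℝ} (hM : ∀ f ∈ H, ∀ x y : S, |f x - f y| ≤ M) (P : Measure S) {n : ℕ}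
    (i : Fin n) (s : Fin n → S) (y : S) :
    empDev H P n s ≤ empDev H P n (Function.update s i y) + M / n := by
  have hM0 : 0 ≤ M := by
    obtain ⟨f, hf⟩ := hne
    exact (abs_nonneg _).trans (hM f hf y y)
  refine Real.iSup_le_iSup_add (by positivity) fun f => ?_
  by_cases hf : f ∈ H
  · have hsum : (∑ j, f (s j)) - ∑ j, f (Function.update s i y j) = f (s i) - f y := by
      rw [← Finset.sum_sub_distrib, Finset.sum_eq_single i]
      · simp
      · intro j _ hj
        simp [hj]
      · simp
    simp only [hf, ciSup_unique]
    refine (abs_abs_sub_abs_le _ _).trans ?_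
    rw [sub_sub_sub_cancel_right, ← sub_div, hsum, abs_div, Nat.abs_cast]
    gcongr
    exact hM f hf _ _
  · simp only [hf, Real.iSup_of_isEmpty, sub_self, abs_zero]
    positivity

/-- Exchanging one coordinate of `s` with `y` preserves the measure `Pⁿ ⊗ P`. -/
theorem measurePreserving_update_swap {S : Type*} [MeasurableSpace S] (P : Measure S)
    [IsProbabilityMeasure P] {n : ℕ} (i : Fin n) :
    MeasurePreserving (fun p : (Fin n → S) × S => (Function.update p.1 i p.2, p.1 i))
      ((Measure.pi fun _ : Fin n => P).prod P) ((Measure.pi fun _ : Fin n => P).prod P) := by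
  have he := measurePreserving_piFinSuccAbove (fun _ : Fin (n + 1) => P) (Fin.last n)
  have hσ := measurePreserving_piCongrLeft (fun _ : Fin (n + 1) => P)
    (Equiv.swap i.castSucc (Fin.last n))
  have h := (Measure.measurePreserving_swap.comp
    ((he.comp hσ).comp he.symm)).comp Measure.measurePreserving_swap
  have hcongr : ∀ (f : Fin (n + 1) → S) (j : Fin (n + 1)),
      MeasurableEquiv.piCongrLeft (fun _ => S) (Equiv.swap i.castSucc (Fin.last n)) f j =
        f (Equiv.swap i.castSucc (Fin.last n) j) := by
    intro f j
    obtain ⟨k, rfl⟩ := (Equiv.swap i.castSucc (Fin.last n)).surjective j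
    rw [MeasurableEquiv.coe_piCongrLeft, Equiv.piCongrLeft_apply_apply, Equiv.swap_apply_self]
  convert h using 1
  funext ⟨s, y⟩
  refine Prod.ext (funext fun j => ?_) ?_
  · rcases eq_or_ne j i with rfl | hj
    · simp [MeasurableEquiv.piFinSuccAbove, hcongr, Fin.init]
    · have hj' : j.castSucc ≠ i.castSucc := (Fin.castSucc_injective n).ne hj
      simp [MeasurableEquiv.piFinSuccAbove, hcongr, hj, Fin.init,
        Equiv.swap_apply_of_ne_of_ne hj' (Fin.castSucc_ne_last j)]
  · simp [MeasurableEquiv.piFinSuccAbove, hcongr]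

/-- If `|f(x) − f(y)| ≤ M` for all `f ∈ H` and `x, y ∈ S`, and `g` is a measurable cover function
of `s ↦ ‖P_s − P‖_H` with respect to `Pⁿ`, then for `Pⁿ⁺¹`-almost every `(s, y)` and each
coordinate `i`, `| ‖P_s − P‖_H* − ‖P_{s'} − P‖_H* | ≤ M / n`, where `s'` is `s` with its `i`-th
coordinate replaced by `y`; i.e. `‖P_n − P‖_H*` is weakly difference-bounded by
`(4M, M n⁻¹, 0)`. -/
theorem measCover_weakly_difference_bounded {S : Type*} [MeasurableSpace S]
    (H : Set (S → ℝ)) (hne : H.Nonempty)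
    (M : ℝ) (hM : ∀ f ∈ H, ∀ x y : S, |f x - f y| ≤ M)
    (n : ℕ) (hn : 0 < n)
    (P : MeasureTheory.Measure S) (hP : MeasureTheory.IsProbabilityMeasure P)
    (g : (Fin n → S) → ℝ)
    (hg : IsMeasCover (MeasureTheory.Measure.pi fun _ : Fin n => P) (empDev H P n) g)
    (i : Fin n) :
    ∀ᵐ p : (Fin n → S) × S ∂(MeasureTheory.Measure.pi fun _ : Fin n => P).prod P,
      |g p.1 - g (Function.update p.1 i p.2)| ≤ M / n := by
  set μ := Measure.pi fun _ : Fin n => P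
  obtain ⟨hgm, hge, hmin⟩ := hg
  have hT := measurePreserving_update_swap P i
  have hupd : Measurable fun p : (Fin n → S) × S => Function.update p.1 i p.2 := hT.measurable.fst
  have hle : ∀ᵐ p : (Fin n → S) × S ∂μ.prod P,
      empDev H P n p.1 ≤ g (Function.update p.1 i p.2) + M / n := by
    have hΦ := Measure.quasiMeasurePreserving_fst.comp hT.quasiMeasurePreserving
    filter_upwards [hΦ.ae hge] with p hp
    exact (empDev_le_empDev_update_add hne hM P i p.1 p.2).trans (by gcongr; exact hp)
  have hcover : ∀ᵐ p : (Fin n → S) × S ∂μ.prod P,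
      g p.1 ≤ g (Function.update p.1 i p.2) + M / n := by
    have hle' := Measure.ae_ae_of_ae_prod
      ((Measure.measurePreserving_swap (μ := P) (ν := μ)).quasiMeasurePreserving.ae hle)
    have hms : MeasurableSet {p : S × (Fin n → S) |
        g p.2 ≤ g (Function.update p.2 i p.1) + M / n} :=
      measurableSet_le (hgm.comp measurable_snd)
        (((hgm.comp hupd).comp measurable_swap).add_const _)
    have hswap : ∀ᵐ p : S × (Fin n → S) ∂P.prod μ,
        g p.2 ≤ g (Function.update p.2 i p.1) + M / n := by
      refine (Measure.ae_prod_iff_ae_ae hms).2 ?_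
      filter_upwards [hle'] with y hy
      exact hmin _ (((hgm.comp hupd).comp measurable_prodMk_right).add_const _) hy
    exact (Measure.measurePreserving_swap (μ := μ) (ν := P)).quasiMeasurePreserving.ae hswap
  filter_upwards [hcover, hT.quasiMeasurePreserving.ae hcover] with p h₁ h₂
  simp only [Function.update_idem, Function.update_eq_self] at h₂
  rw [abs_le]
  constructor <;> linarith
end
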